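/- If P is V-stable, then P is modified V-stable; that is, any two DAGs G_1, G_2 with sk(G_1) = sk(G_2) = sk(P) such that P is V-OUS and collider-stable with respect to both G_1 and G_2 are Markov equivalent. -/

import Mathlib

open MeasureTheory ProbabilityTheory

/-- A directed acyclic graph on vertex set `V`: a directed edge relation with no
directed cycles (a directed path from a node to itself). -/
structure DAG (V : Type*) where
  Edge : V → V → Prop
  acyclic : ∀ i, ¬ Relation.TransGen Edge i i

namespace DAG

variable {V : Type*}

/-- `i` and `j` are adjacent if there is a directed edge between them in either direction. -/
def Adj (G : DAG V) (i j : V) : Prop := G.Edge i j ∨ G.Edge j i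

/-- `an_G(C)`: the set of nodes not in `C` with a directed path to some node of `C`. -/
def ancestors (G : DAG V) (C : Set V) : Set V :=
  {i | i ∉ C ∧ ∃ j ∈ C, Relation.TransGen G.Edge i j}

/-- A path between `a` and `b` in (the skeleton of) a DAG `G`: a sequence of at least two
distinct vertices starting at `a`, ending at `b`, with consecutive vertices adjacent. -/
structure Path (G : DAG V) (a b : V) where
  n : ℕ
  npos : 0 < n
  f : Fin (n + 1) → V
  first : f 0 = a
  last : f (Fin.last n) = b
  adj : ∀ i : Fin n, G.Adj (f i.castSucc) (f i.succ)
  inj : Function.Injective f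

/-- The intermediate node at position `t` of the path is a collider on the path:
both incident edges of the path point into it. -/
def Path.ColliderAt {G : DAG V} {a b : V} (π : Path G a b) (t : ℕ)
    (h1 : 0 < t) (h2 : t < π.n) : Prop :=
  G.Edge (π.f ⟨t - 1, by omega⟩) (π.f ⟨t, by omega⟩) ∧
  G.Edge (π.f ⟨t + 1, by omega⟩) (π.f ⟨t, by omega⟩)

/-- A path is blocked by `C` if some intermediate non-collider on the path lies in `C`,
or some collider `m` on the path satisfies `m ∉ C ∪ an_G(C)`. -/
def Path.Blocked {G : DAG V} {a b : V} (π : Path G a b) (C : Set V) : Prop :=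
  ∃ (t : ℕ) (h1 : 0 < t) (h2 : t < π.n),
    (¬ π.ColliderAt t h1 h2 ∧ π.f ⟨t, by omega⟩ ∈ C) ∨
    (π.ColliderAt t h1 h2 ∧ π.f ⟨t, by omega⟩ ∉ C ∪ G.ancestors C)

/-- d-separation: every path between a node of `A` and a node of `B` is blocked by `C`. -/
def dSep (G : DAG V) (A B C : Set V) : Prop :=
  ∀ a ∈ A, ∀ b ∈ B, ∀ π : Path G a b, π.Blocked C

/-- Two DAGs are Markov equivalent if they have exactly the same d-separations. -/
def MarkovEquiv (G₁ G₂ : DAG V) : Prop :=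
  ∀ A B C : Set V, Disjoint A B → Disjoint A C → Disjoint B C →
    (G₁.dSep A B C ↔ G₂.dSep A B C)

/-- A v-configuration `i ∼ k ∼ j` in the DAG: `i, k, j` distinct, `i` and `j` each
adjacent to `k`, but `i` and `j` not adjacent. -/
def VConfig (G : DAG V) (i k j : V) : Prop :=
  i ≠ j ∧ i ≠ k ∧ j ≠ k ∧ G.Adj i k ∧ G.Adj j k ∧ ¬ G.Adj i j

/-- A collider v-configuration `i → k ← j`. -/
def IsCollider (G : DAG V) (i k j : V) : Prop :=
  G.VConfig i k j ∧ G.Edge i k ∧ G.Edge j k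

/-- A non-collider v-configuration. -/
def IsNonCollider (G : DAG V) (i k j : V) : Prop :=
  G.VConfig i k j ∧ ¬ (G.Edge i k ∧ G.Edge j k)

end DAG

/-- A v-configuration `i ∼ k ∼ j` in an undirected graph given by an adjacency relation. -/
def VConfigRel {V : Type*} (A : V → V → Prop) (i k j : V) : Prop :=
  i ≠ j ∧ i ≠ k ∧ j ≠ k ∧ A i k ∧ A j k ∧ ¬ A i j

section Prob

variable {V : Type*} {Ω : Type*} [MeasurableSpace Ω] [StandardBorelSpace Ω] [Nonempty Ω]
  {E : V → Type*} [∀ i, MeasurableSpace (E i)]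

/-- `A ⫫ B | C`: the families `(X i)_{i ∈ A}` and `(X j)_{j ∈ B}` are conditionally
independent given the σ-algebra generated by `(X k)_{k ∈ C}`, under `μ`. -/
def CI (μ : Measure Ω) [IsFiniteMeasure μ] (X : ∀ i, Ω → E i)
    (hX : ∀ i, Measurable (X i)) (A B C : Set V) : Prop :=
  CondIndepFun (MeasurableSpace.comap (fun ω => fun k : C => X k.1 ω) inferInstance)
    ((measurable_pi_iff.mpr fun k : C => hX k.1).comap_le)
    (fun ω => fun i : A => X i.1 ω) (fun ω => fun j : B => X j.1 ω) μ

variable (μ : Measure Ω) [IsFiniteMeasure μ] (X : ∀ i, Ω → E i) (hX : ∀ i, Measurable (X i))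

/-- The skeleton of `P`: distinct `i, j` are adjacent iff no `C ⊆ V \ {i,j}` renders
`{i} ⫫ {j} | C`. -/
def SkP (i j : V) : Prop :=
  i ≠ j ∧ ¬ ∃ C : Set V, C ⊆ ({i, j} : Set V)ᶜ ∧ CI μ X hX {i} {j} C

/-- `P` is Markovian to `G`: every d-separation implies the corresponding
conditional independence. -/
def MarkovTo (G : DAG V) : Prop :=
  ∀ A B C : Set V, Disjoint A B → Disjoint A C → Disjoint B C →
    G.dSep A B C → CI μ X hX A B C

/-- Adjacency faithfulness: adjacent nodes of `G` are separated by no conditioning set. -/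
def AdjFaithful (G : DAG V) : Prop :=
  ∀ i j : V, G.Adj i j → ¬ ∃ C : Set V, C ⊆ ({i, j} : Set V)ᶜ ∧ CI μ X hX {i} {j} C

/-- `sk(P) = sk(G)`. -/
def SkelEq (G : DAG V) : Prop :=
  ∀ i j : V, G.Adj i j ↔ SkP μ X hX i j

/-- V-ordered upward stability wrt `G`. -/
def VOUS (G : DAG V) : Prop :=
  ∀ i k j : V, G.IsNonCollider i k j → ∀ C : Set V, C ⊆ ({i, j, k} : Set V)ᶜ →
    CI μ X hX {i} {j} C → CI μ X hX {i} {j} (C ∪ {k})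

/-- Collider-stability wrt `G`. -/
def ColliderStable (G : DAG V) : Prop :=
  ∀ i k j : V, G.IsCollider i k j →
    ∃ C : Set V, C ⊆ ({i, j, k} : Set V)ᶜ ∧ CI μ X hX {i} {j} C

/-- V-stability of `P`. -/
def VStable : Prop :=
  ∀ i k j : V, VConfigRel (SkP μ X hX) i k j → ∀ C : Set V, C ⊆ ({i, j, k} : Set V)ᶜ →
    ¬ (CI μ X hX {i} {j} C ∧ CI μ X hX {i} {j} (C ∪ {k}))

/-- The orientation rule assigns the v-configuration `i ∼ k ∼ j` of `sk(P)` to be a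
collider. -/
def AssignedCollider (i k j : V) : Prop :=
  VConfigRel (SkP μ X hX) i k j ∧
  ∃ C : Set V, C ⊆ ({i, j, k} : Set V)ᶜ ∧
    CI μ X hX {i} {j} C ∧ ¬ CI μ X hX {i} {j} (C ∪ {k})

/-- The orientation rule assigns the v-configuration `i ∼ k ∼ j` of `sk(P)` to be a
non-collider. -/
def AssignedNonCollider (i k j : V) : Prop :=
  VConfigRel (SkP μ X hX) i k j ∧
  ∀ C : Set V, C ⊆ ({i, j} : Set V)ᶜ → CI μ X hX {i} {j} C → k ∈ C

/-- A DAG `G` satisfies the V-OUS and collider-stable orientation rule wrt `P`. -/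
def SatisfiesRule (G : DAG V) : Prop :=
  SkelEq μ X hX G ∧
  (∀ i k j : V, AssignedCollider μ X hX i k j → G.IsCollider i k j) ∧
  (∀ i k j : V, AssignedNonCollider μ X hX i k j → G.IsNonCollider i k j)

/-- Modified V-stability: any two DAGs `G` with `sk(G) = sk(P)` to which `P` is V-OUS and
collider-stable are Markov equivalent. -/
def ModifiedVStable : Prop :=
  ∀ G₁ G₂ : DAG V,
    SkelEq μ X hX G₁ → VOUS μ X hX G₁ → ColliderStable μ X hX G₁ →
    SkelEq μ X hX G₂ → VOUS μ X hX G₂ → ColliderStable μ X hX G₂ →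
    DAG.MarkovEquiv G₁ G₂

/-- Ordered upward stability wrt `G`. -/
def OUS (G : DAG V) : Prop :=
  ∀ i j k : V, i ≠ j → i ≠ k → j ≠ k → k ∈ G.ancestors {i, j} →
    ∀ C : Set V, C ⊆ ({i, j, k} : Set V)ᶜ →
      CI μ X hX {i} {j} C → CI μ X hX {i} {j} (C ∪ {k})

/-- Ordered downward stability wrt `G`. -/
def ODS (G : DAG V) : Prop :=
  ∀ i j k : V, i ≠ j → i ≠ k → j ≠ k →
    ∀ C : Set V, C ⊆ ({i, j, k} : Set V)ᶜ → k ∉ G.ancestors ({i, j} ∪ C) →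
      CI μ X hX {i} {j} (C ∪ {k}) → CI μ X hX {i} {j} C

end Prob

namespace DAG

variable {V : Type*}

theorem edge_asymm (G : DAG V) {i j : V} (h : G.Edge i j) : ¬ G.Edge j i := fun h' =>
  G.acyclic i (.tail (.single h) h')

theorem edge_irrefl (G : DAG V) (i : V) : ¬ G.Edge i i := fun h => G.acyclic i (.single h)

/-- States of the ball-passing process for the edge relation `E` started at `a`: `Reach E C a v h`
holds if some walk from `a` to `v` has all its colliders in `C` and all its non-colliders outside
`C`, where `h` is `true` if the last edge points into `v`, and `false` if it points out of `v`
or the walk is trivial. -/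
inductive Reach (E : V → V → Prop) (C : Set V) (a : V) : V → Bool → Prop
  | start : Reach E C a a false
  | out {v w : V} {h : Bool} : Reach E C a v h → v ∉ C → E v w → Reach E C a w true
  | back {v w : V} : Reach E C a v false → v ∉ C → E w v → Reach E C a w false
  | collide {v w : V} : Reach E C a v true → v ∈ C → E w v → Reach E C a w false

/-- Reversing a covered edge `x → y` preserves reachability by open walks. -/
theorem Reach.reverse_covered {E E' : V → V → Prop} {C : Set V} {a x y : V}
    (hxy : x ≠ y) (hyx : ¬ E y x) (hx : ¬ E x x) (hy : ¬ E y y)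
    (hcov : ∀ p, p ≠ x → (E p y ↔ E p x))
    (hE' : ∀ u v, E' u v ↔ (E u v ∧ ¬ (u = x ∧ v = y)) ∨ (u = y ∧ v = x))
    {b : V} {h : Bool} (hr : Reach E C a b h) : ∃ h', Reach E' C a b h' := by
  have hyx' : E' y x := (hE' y x).2 (Or.inr ⟨rfl, rfl⟩)
  have keep {u v : V} (huv : E u v) (hne : u ≠ x ∨ v ≠ y) : E' u v :=
    (hE' u v).2 (Or.inl ⟨huv, by tauto⟩)
  have parx {p : V} (hp : E p x) : E' p x ∧ E' p y := by
    have hpx : p ≠ x := fun e => hx (e ▸ hp)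
    exact ⟨keep hp (.inl hpx), keep ((hcov p hpx).2 hp) (.inl hpx)⟩
  have pary {p : V} (hp : E p y) (hpx : p ≠ x) : E' p x ∧ E' p y :=
    parx ((hcov p hpx).1 hp)
  have key : (b ≠ x → b ≠ y → Reach E' C a b h) ∧
      (b = x → h = true → Reach E' C a x true ∧ Reach E' C a y true) ∧
      (b = x → h = false → Reach E' C a x false ∨ (Reach E' C a x true ∧
        ((y ∉ C ∧ Reach E' C a y false) ∨ (y ∈ C ∧ Reach E' C a y true)))) ∧
      (b = y → h = false → Reach E' C a y false) ∧
      (b = y → h = true → (Reach E' C a x true ∧ Reach E' C a y true) ∨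
        (x ∉ C ∧ Reach E' C a x false) ∨ (y ∉ C ∧ Reach E' C a y false)) := by
    induction hr with
    | start =>
      refine ⟨fun _ _ => .start, by simp, ?_, ?_, by simp⟩
      · rintro rfl -; exact .inl .start
      · rintro rfl -; exact .start
    | out | back | collide => grind [Reach.out, Reach.back, Reach.collide]
  obtain ⟨k1, k2, k3, k4, k5⟩ := key
  by_cases hbx : b = x
  · subst hbx
    cases h
    · rcases k3 rfl rfl with h | h
      exacts [⟨_, h⟩, ⟨_, h.1⟩]
    · exact ⟨_, (k2 rfl rfl).1⟩
  · by_cases hby : b = y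
    · subst hby
      cases h
      · exact ⟨_, k4 rfl rfl⟩
      · rcases k5 rfl rfl with h | h | h
        exacts [⟨_, h.2⟩, ⟨_, .back h.2 h.1 hyx'⟩, ⟨_, h.2⟩]
    · exact ⟨_, k1 hbx hby⟩

/-- Reversal of a covered edge `x → y`. -/
def reverseCovered (G : DAG V) (x y : V) (hxy : G.Edge x y)
    (hcov : ∀ p, p ≠ x → (G.Edge p y ↔ G.Edge p x)) : DAG V where
  Edge u v := (G.Edge u v ∧ ¬ (u = x ∧ v = y)) ∨ (u = y ∧ v = x)
  acyclic := by
    set F : V → V → Prop := fun u v => G.Edge u v ∧ ¬ (u = x ∧ v = y)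
    have hFG : ∀ u v, F u v → G.Edge u v := fun _ _ h => h.1
    have key : ∀ u v, Relation.TransGen (fun u v => F u v ∨ (u = y ∧ v = x)) u v →
        Relation.TransGen F u v ∨
          (Relation.ReflTransGen F u y ∧ Relation.ReflTransGen F x v) := by
      intro u v h
      induction h with
      | single h =>
        rcases h with h | ⟨rfl, rfl⟩
        · exact .inl (.single h)
        · exact .inr ⟨.refl, .refl⟩
      | tail _ h ih =>
        rcases h with h | ⟨rfl, rfl⟩
        · rcases ih with ih | ih
          · exact .inl (ih.tail h)
          · exact .inr ⟨ih.1, ih.2.tail h⟩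
        · rcases ih with ih | ih
          · exact .inr ⟨ih.to_reflTransGen, .refl⟩
          · exact .inr ⟨ih.1, .refl⟩
    intro i hi
    rcases key i i hi with h | ⟨h1, h2⟩
    · exact G.acyclic i (Relation.TransGen.mono hFG _ _ h)
    · rcases Relation.ReflTransGen.cases_tail (h2.trans h1) with h | ⟨z, hz, hzy⟩
      · subst h; exact G.edge_irrefl _ hxy
      · have hzx : z ≠ x := fun e => hzy.2 ⟨e, rfl⟩
        exact G.acyclic x (.tail' (Relation.ReflTransGen.mono hFG _ _ hz) ((hcov z hzx).1 hzy.1))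

/-- Among two DAGs with the same skeleton and the same unshielded colliders, every open walk of
the first yields an open walk of the second. -/
theorem Reach.of_same_colliders [Finite V] {C : Set V} {a b : V} (G₁ G₂ : DAG V)
    (hadj : ∀ i j, G₁.Adj i j ↔ G₂.Adj i j)
    (hcol : ∀ i k j, i ≠ j → ¬ G₁.Adj i j →
      (G₁.Edge i k ∧ G₁.Edge j k ↔ G₂.Edge i k ∧ G₂.Edge j k))
    {h : Bool} (hr : Reach G₁.Edge C a b h) : ∃ h', Reach G₂.Edge C a b h' := by
  induction hn : {p : V × V | G₁.Edge p.1 p.2 ∧ G₂.Edge p.2 p.1}.ncard using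
    Nat.strong_induction_on generalizing G₁ h with
  | _ n ih =>
  have wf : WellFounded (Relation.TransGen G₁.Edge) :=
    haveI : Std.Irrefl (Relation.TransGen G₁.Edge) := ⟨G₁.acyclic⟩
    Finite.wellFounded_of_trans_of_irrefl _
  have wf' : WellFounded (Function.swap (Relation.TransGen G₁.Edge)) :=
    haveI : Std.Irrefl (Function.swap (Relation.TransGen G₁.Edge)) := ⟨G₁.acyclic⟩
    Finite.wellFounded_of_trans_of_irrefl _
  by_cases hne : ∃ y x, G₁.Edge x y ∧ G₂.Edge y x
  · obtain ⟨y, ⟨x₀, hx₀⟩, hymin⟩ := wf.has_min {y | ∃ x, G₁.Edge x y ∧ G₂.Edge y x} hne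
    obtain ⟨x, ⟨hxy, hyx⟩, hxmax⟩ :=
      wf'.has_min {x | G₁.Edge x y ∧ G₂.Edge y x} ⟨x₀, hx₀⟩
    have hmin : ∀ u v, G₁.Edge u v → G₁.Edge v y → ¬ G₂.Edge v u := fun u v huv hvy hvu =>
      hymin v ⟨u, huv, hvu⟩ (.single hvy)
    have hmax : ∀ z, G₁.Edge x z → G₁.Edge z y → ¬ G₂.Edge y z := fun z hxz hzy hyz =>
      hxmax z ⟨hzy, hyz⟩ (.single hxz)
    have hcov : ∀ p, p ≠ x → (G₁.Edge p y ↔ G₁.Edge p x) := by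
      have e1 := @edge_asymm _ G₁
      have e2 := @edge_asymm _ G₂
      intro z hzx
      constructor
      · intro hzy
        by_cases ha : G₁.Adj z x
        · rcases ha with ha | ha
          · exact ha
          · have h1 := hmax z ha hzy
            have h2 := hmin x z ha hzy
            have h3 : G₂.Edge z y := ((hadj z y).1 (.inl hzy)).resolve_right h1
            have h4 : G₂.Edge x z := ((hadj x z).1 (.inl ha)).resolve_right h2
            exact (G₂.acyclic x (.tail (.tail (.single h4) h3) hyx)).elim
        · exact (e2 hyx ((hcol z y x hzx ha).1 ⟨hzy, hxy⟩).2).elim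
      · intro hz
        have h1 : G₂.Edge z x := ((hadj z x).1 (.inl hz)).resolve_right (hmin z x hz hxy)
        by_cases ha : G₁.Adj z y
        · refine ha.resolve_right fun hyz => ?_
          exact G₁.acyclic x (.tail (.tail (.single hxy) hyz) hz)
        · have hzy : z ≠ y := by rintro rfl; exact e1 hz hxy
          exact (e1 hxy ((hcol z x y hzy ha).2 ⟨h1, hyx⟩).2).elim
    have hne' : x ≠ y := by rintro rfl; exact G₁.edge_irrefl _ hxy
    obtain ⟨h', hr'⟩ := hr.reverse_covered (E' := (G₁.reverseCovered x y hxy hcov).Edge) hne'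
      (G₁.edge_asymm hxy) (G₁.edge_irrefl x) (G₁.edge_irrefl y) hcov (fun _ _ => Iff.rfl)
    have hadj' : ∀ i j, (G₁.reverseCovered x y hxy hcov).Adj i j ↔ G₁.Adj i j := by
      intro i j
      simp only [Adj, reverseCovered]
      grind
    refine ih _ ?_ (G₁.reverseCovered x y hxy hcov) (fun i j => (hadj' i j).trans (hadj i j))
      (fun i k j hij hn => ?_) hr' rfl
    · rw [← hn]
      refine Set.ncard_lt_ncard ⟨?_, fun hs => ?_⟩ (Set.toFinite _)
      · rintro ⟨u, v⟩ ⟨h1 | ⟨rfl, rfl⟩, h2⟩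
        · exact ⟨h1.1, h2⟩
        · exact (G₂.edge_asymm hyx h2).elim
      · rcases (hs (show (x, y) ∈ _ from ⟨hxy, hyx⟩)).1 with h | h
        · exact h.2 ⟨rfl, rfl⟩
        · exact hne' h.1
    · rw [hadj'] at hn
      rw [← hcol i k j hij hn]
      have e1 := @edge_asymm _ G₁
      simp only [Adj, reverseCovered] at hn ⊢
      grind
  · have heq : G₁.Edge = G₂.Edge := by
      ext u v
      have h1 := hadj u v
      have h2 := @edge_asymm _ G₁ u v
      push Not at hne
      have h3 := hne u v
      have h4 := hne v u
      simp only [Adj] at h1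
      tauto
    exact ⟨h, heq ▸ hr⟩

theorem Reach.bounce {G : DAG V} {C : Set V} {a m c : V} (hc : c ∈ C)
    (hmc : Relation.TransGen G.Edge m c) (hm : m ∉ C) {h : Bool} (hr : Reach G.Edge C a m h) :
    Reach G.Edge C a m false := by
  induction hmc using Relation.TransGen.head_induction_on generalizing h with
  | single hmc => exact .collide (.out hr hm hmc) hc hmc
  | @head m m' hmm' _ ih =>
    by_cases hm' : m' ∈ C
    · exact .collide (.out hr hm hmm') hm' hmm'
    · exact .back (ih hm' (.out hr hm hmm')) hm' hmm'

/-- An unblocked path gives an open walk. -/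
theorem Path.reach_of_not_blocked {G : DAG V} {C : Set V} {a b : V} (ha : a ∉ C)
    (π : Path G a b) (hπ : ¬ π.Blocked C) : ∃ h, Reach G.Edge C a b h := by
  have key : ∀ t (ht : t < π.n),
      (G.Edge (π.f ⟨t, by omega⟩) (π.f ⟨t + 1, by omega⟩) →
        Reach G.Edge C a (π.f ⟨t + 1, by omega⟩) true) ∧
      (G.Edge (π.f ⟨t + 1, by omega⟩) (π.f ⟨t, by omega⟩) →
        Reach G.Edge C a (π.f ⟨t + 1, by omega⟩) false) := by
    intro t
    induction t with
    | zero =>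
      intro ht
      have h0 : π.f ⟨0, by omega⟩ = a := π.first
      rw [h0]
      exact ⟨fun h => .out .start ha h, fun h => .back .start ha h⟩
    | succ t ih =>
      intro ht
      obtain ⟨i1, i2⟩ := ih (by omega)
      have hadj : G.Adj (π.f ⟨t, by omega⟩) (π.f ⟨t + 1, by omega⟩) := π.adj ⟨t, by omega⟩
      have hb := fun hb => hπ ⟨t + 1, Nat.succ_pos t, ht, hb⟩
      obtain ⟨b1, b2⟩ := not_or.1 hb
      simp only [Path.ColliderAt, Nat.add_sub_cancel] at b1 b2
      push Not at b1 b2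
      constructor
      · intro h
        have hC := b1 (fun _ => G.edge_asymm h)
        rcases hadj with h' | h'
        · exact .out (i1 h') hC h
        · exact .out (i2 h') hC h
      · intro h
        rcases hadj with h' | h'
        · rcases b2 ⟨h', h⟩ with hC | ⟨hC, c, hc, hmc⟩
          · exact .collide (i1 h') hC h
          · exact .back ((i1 h').bounce hc hmc hC) hC h
        · exact .back (i2 h') (b1 fun h'' => (G.edge_asymm h' h'').elim) h
  have hn := π.npos
  have hlast : π.f ⟨π.n - 1 + 1, by omega⟩ = b := by
    refine Eq.trans (congrArg π.f (Fin.ext ?_)) π.last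
    simp only [Fin.val_last]
    omega
  have hadj : G.Adj (π.f ⟨π.n - 1, by omega⟩) (π.f ⟨π.n - 1 + 1, by omega⟩) :=
    π.adj ⟨π.n - 1, by omega⟩
  obtain ⟨k1, k2⟩ := key (π.n - 1) (by omega)
  rw [hlast] at k1 k2 hadj
  rcases hadj with h | h
  exacts [⟨_, k1 h⟩, ⟨_, k2 h⟩]

/-- The first `n + 1` values of `f` form an unblocked path of `G` given `C` starting at `a`, the
trivial path being allowed. -/
structure IsOpenPath (G : DAG V) (C : Set V) (a : V) (n : ℕ) (f : ℕ → V) : Prop where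
  first : f 0 = a
  adj : ∀ i < n, G.Adj (f i) (f (i + 1))
  inj : Set.InjOn f (Set.Iic n)
  collider : ∀ i, i + 1 < n → G.Edge (f i) (f (i + 1)) → G.Edge (f (i + 2)) (f (i + 1)) →
    f (i + 1) ∈ C ∪ G.ancestors C
  nonCollider : ∀ i, i + 1 < n → ¬ (G.Edge (f i) (f (i + 1)) ∧ G.Edge (f (i + 2)) (f (i + 1))) →
    f (i + 1) ∉ C

/-- Some unblocked path from `a` ends in `v`, with its last edge pointing into `v` if `h` is
`true`; if `h` is `false`, the last edge points out of `v` or the path is trivial. -/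
def OpenPathTo (G : DAG V) (C : Set V) (a v : V) (h : Bool) : Prop :=
  ∃ n f, G.IsOpenPath C a n f ∧ f n = v ∧
    if h then ∃ m, n = m + 1 ∧ G.Edge (f m) v else ∀ m, n = m + 1 → G.Edge v (f m)

theorem IsOpenPath.mono {G : DAG V} {C : Set V} {a : V} {n m : ℕ} {f : ℕ → V}
    (hf : G.IsOpenPath C a n f) (hm : m ≤ n) : G.IsOpenPath C a m f where
  first := hf.first
  adj i hi := hf.adj i (by omega)
  inj := hf.inj.mono (Set.Iic_subset_Iic.2 hm)
  collider i hi := hf.collider i (by omega)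
  nonCollider i hi := hf.nonCollider i (by omega)

theorem IsOpenPath.update {G : DAG V} {C : Set V} {a w : V} {n : ℕ} {f : ℕ → V}
    (hf : G.IsOpenPath C a n f) (hw : ∀ i ≤ n, f i ≠ w) (hadj : G.Adj (f n) w)
    (hcol : ∀ m, n = m + 1 → G.Edge (f m) (f n) → G.Edge w (f n) → f n ∈ C ∪ G.ancestors C)
    (hnon : ∀ m, n = m + 1 → ¬ (G.Edge (f m) (f n) ∧ G.Edge w (f n)) → f n ∉ C) :
    G.IsOpenPath C a (n + 1) (Function.update f (n + 1) w) := by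
  have e1 : Function.update f (n + 1) w (n + 1) = w := by simp
  have e2 : ∀ i ≤ n, Function.update f (n + 1) w i = f i := fun i hi =>
    Function.update_of_ne (by omega) _ _
  refine ⟨by rw [e2 0 (by omega), hf.first], ?_, ?_, ?_, ?_⟩
  · intro i hi
    rcases Nat.lt_succ_iff_lt_or_eq.1 hi with h | rfl
    · rw [e2 i (by omega), e2 (i + 1) (by omega)]; exact hf.adj i h
    · rw [e2 i le_rfl, e1]; exact hadj
  · intro i hi j hj hij
    have := @hf.inj i
    simp only [Set.mem_Iic] at *
    grind
  · intro i hi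
    rcases Nat.lt_succ_iff_lt_or_eq.1 hi with h | h
    · rw [e2 i (by omega), e2 (i + 1) (by omega), e2 (i + 2) (by omega)]
      exact hf.collider i h
    · subst h
      rw [e2 i (by omega), e2 (i + 1) (by omega), e1]
      exact hcol i rfl
  · intro i hi
    rcases Nat.lt_succ_iff_lt_or_eq.1 hi with h | h
    · rw [e2 i (by omega), e2 (i + 1) (by omega), e2 (i + 2) (by omega)]
      exact hf.nonCollider i h
    · subst h
      rw [e2 i (by omega), e2 (i + 1) (by omega), e1]
      exact hnon i rfl

/-- On an unblocked path, a directed edge out of `f s` continues as a directed path up to the end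
of the path or up to a collider, which has a descendant in `C`. -/
theorem IsOpenPath.mem_or_transGen {G : DAG V} {C : Set V} {a : V} {n : ℕ} {f : ℕ → V}
    (hf : G.IsOpenPath C a n f) {s : ℕ} (hs : s < n) (hout : G.Edge (f s) (f (s + 1))) :
    (∃ c ∈ C, Relation.TransGen G.Edge (f s) c) ∨
      (Relation.TransGen G.Edge (f s) (f n) ∧ ∃ m, n = m + 1 ∧ G.Edge (f m) (f n)) := by
  obtain ⟨k, rfl⟩ : ∃ k, n = s + 1 + k := ⟨n - (s + 1), by omega⟩
  induction k generalizing s with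
  | zero => exact .inr ⟨.single hout, s, rfl, hout⟩
  | succ k ih =>
    rcases hf.adj (s + 1) (by omega) with h | h
    · have := ih (s := s + 1) h (by rwa [show s + 1 + 1 + k = s + 1 + (k + 1) by omega])
        (by omega)
      rw [show s + 1 + 1 + k = s + 1 + (k + 1) by omega] at this
      rcases this with ⟨c, hc, hcc⟩ | ⟨h1, h2⟩
      · exact .inl ⟨c, hc, .head hout hcc⟩
      · exact .inr ⟨.head hout h1, h2⟩
    · rcases hf.collider s (by omega) hout h with hC | ⟨-, c, hc, hcc⟩
      · exact .inl ⟨_, hC, .single hout⟩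
      · exact .inl ⟨c, hc, .head hout hcc⟩

/-- Prolonging an unblocked path by an edge into `w`, or cutting it at `w`. -/
theorem IsOpenPath.extend_out {G : DAG V} {C : Set V} {a w : V} {n : ℕ} {f : ℕ → V} (ha : a ∉ C)
    (hf : G.IsOpenPath C a n f) (hC : f n ∉ C) (hw : G.Edge (f n) w) :
    G.OpenPathTo C a w true ∨ (G.OpenPathTo C a w false ∧ w ∉ C) := by
  by_cases hmem : ∃ s ≤ n, f s = w
  · obtain ⟨s, hs, rfl⟩ := hmem
    have hsn : s < n := lt_of_le_of_ne hs fun e => G.edge_irrefl _ (e ▸ hw)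
    rcases s with - | s
    · refine .inr ⟨⟨0, f, hf.mono hs, rfl, by simp⟩, by rwa [hf.first]⟩
    · by_cases h : G.Edge (f s) (f (s + 1))
      · exact .inl ⟨s + 1, f, hf.mono hs, rfl, by simpa using h⟩
      · refine .inr ⟨⟨s + 1, f, hf.mono hs, rfl, ?_⟩, hf.nonCollider s hsn fun h' => h h'.1⟩
        simpa using (hf.adj s (by omega)).resolve_left h
  · push Not at hmem
    refine .inl ⟨n + 1, Function.update f (n + 1) w, hf.update hmem (.inl hw)
      (fun _ _ _ h => (G.edge_asymm hw h).elim) (fun _ _ _ => hC), by simp, ?_⟩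
    simpa using hw

/-- Prolonging an unblocked path by an edge out of `w`, or cutting it at `w`. -/
theorem IsOpenPath.extend_back {G : DAG V} {C : Set V} {a w : V} {n : ℕ} {f : ℕ → V}
    (hf : G.IsOpenPath C a n f) (hw : G.Edge w (f n))
    (hcol : ∀ m, n = m + 1 → G.Edge (f m) (f n) → f n ∈ C ∪ G.ancestors C)
    (hnon : ∀ m, n = m + 1 → ¬ G.Edge (f m) (f n) → f n ∉ C) :
    G.OpenPathTo C a w false ∨ (G.OpenPathTo C a w true ∧ w ∈ C ∪ G.ancestors C) := by
  by_cases hmem : ∃ s ≤ n, f s = w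
  · obtain ⟨s, hs, rfl⟩ := hmem
    have hsn : s < n := lt_of_le_of_ne hs fun e => G.edge_irrefl _ (e ▸ hw)
    rcases s with - | s
    · exact .inl ⟨0, f, hf.mono hs, rfl, by simp⟩
    · by_cases h : G.Edge (f s) (f (s + 1))
      · refine .inr ⟨⟨s + 1, f, hf.mono hs, rfl, by simpa using h⟩, ?_⟩
        have hanc : (∃ c ∈ C, Relation.TransGen G.Edge (f (s + 1)) c) →
            f (s + 1) ∈ C ∪ G.ancestors C := fun ⟨c, hc, hcc⟩ =>
          or_iff_not_imp_left.2 fun hC => ⟨hC, c, hc, hcc⟩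
        rcases hf.adj (s + 1) hsn with h' | h'
        · rcases hf.mem_or_transGen hsn h' with hh | ⟨hh, m, hm, hmn⟩
          · exact hanc hh
          · rcases hcol m hm hmn with hC | ⟨-, c, hc, hcc⟩
            · exact hanc ⟨_, hC, hh⟩
            · exact hanc ⟨c, hc, hh.trans hcc⟩
        · exact hf.collider s hsn h h'
      · refine .inl ⟨s + 1, f, hf.mono hs, rfl, ?_⟩
        simpa using (hf.adj s (by omega)).resolve_left h
  · push Not at hmem
    refine .inl ⟨n + 1, Function.update f (n + 1) w, hf.update hmem (.inr hw)
      (fun m hm h _ => hcol m hm h) (fun m hm h => hnon m hm fun h' => h ⟨h', hw⟩), by simp, ?_⟩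
    simpa using hw

theorem OpenPathTo.out {G : DAG V} {C : Set V} {a v w : V} {h : Bool} (ha : a ∉ C)
    (hv : G.OpenPathTo C a v h) (hC : v ∉ C) (hw : G.Edge v w) :
    G.OpenPathTo C a w true ∨ (G.OpenPathTo C a w false ∧ w ∉ C) := by
  obtain ⟨n, f, hf, rfl, -⟩ := hv
  exact hf.extend_out ha hC hw

theorem OpenPathTo.back {G : DAG V} {C : Set V} {a v w : V}
    (hv : G.OpenPathTo C a v false) (hC : v ∉ C) (hw : G.Edge w v) :
    G.OpenPathTo C a w false ∨ (G.OpenPathTo C a w true ∧ w ∈ C ∪ G.ancestors C) := by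
  obtain ⟨n, f, hf, rfl, hm⟩ := hv
  simp only [Bool.false_eq_true, if_false] at hm
  exact hf.extend_back hw (fun m e h => (G.edge_asymm h (hm m e)).elim) (fun _ _ _ => hC)

theorem OpenPathTo.collide {G : DAG V} {C : Set V} {a v w : V}
    (hv : G.OpenPathTo C a v true) (hC : v ∈ C ∪ G.ancestors C) (hw : G.Edge w v) :
    G.OpenPathTo C a w false ∨ (G.OpenPathTo C a w true ∧ w ∈ C ∪ G.ancestors C) := by
  obtain ⟨n, f, hf, rfl, hm⟩ := hv
  simp only [if_true] at hm
  obtain ⟨m, rfl, hm⟩ := hm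
  refine hf.extend_back hw (fun _ _ _ => hC) (fun m' e h => ?_)
  obtain rfl : m = m' := by omega
  exact (h hm).elim

/-- An open walk can be shortened to an unblocked path. -/
theorem Reach.exists_openPathTo {G : DAG V} {C : Set V} {a v : V} {h : Bool} (ha : a ∉ C)
    (hr : Reach G.Edge C a v h) : ∃ h', G.OpenPathTo C a v h' := by
  have key : if h then G.OpenPathTo C a v true ∨ (G.OpenPathTo C a v false ∧ v ∉ C)
      else G.OpenPathTo C a v false ∨ (G.OpenPathTo C a v true ∧ v ∈ C ∪ G.ancestors C) := by
    induction hr with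
    | start =>
      exact .inl ⟨0, fun _ => a, ⟨rfl, by simp, by simp [Set.InjOn], by simp, by simp⟩, rfl,
        by simp⟩
    | @out v w h _ hC hw ih =>
      have : ∃ h', G.OpenPathTo C a v h' := by
        cases h <;> rcases ih with ih | ih
        exacts [⟨_, ih⟩, ⟨_, ih.1⟩, ⟨_, ih⟩, ⟨_, ih.1⟩]
      exact this.choose_spec.out ha hC hw
    | back _ hC hw ih =>
      rcases ih with ih | ih
      · exact ih.back hC hw
      · exact ih.1.collide ih.2 hw
    | collide _ hC hw ih =>
      rcases ih with ih | ih
      · exact ih.collide (.inl hC) hw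
      · exact (ih.2 hC).elim
  cases h <;> rcases key with h | h
  exacts [⟨_, h⟩, ⟨_, h.1⟩, ⟨_, h⟩, ⟨_, h.1⟩]

theorem OpenPathTo.exists_path {G : DAG V} {C : Set V} {a b : V} {h : Bool} (hab : a ≠ b)
    (hb : G.OpenPathTo C a b h) : ∃ π : Path G a b, ¬ π.Blocked C := by
  obtain ⟨n, f, hf, rfl, -⟩ := hb
  have hn : 0 < n := by
    rcases Nat.eq_zero_or_pos n with rfl | h
    · exact (hab hf.first.symm).elim
    · exact h
  refine ⟨⟨n, hn, fun i => f i, hf.first, rfl, fun i => hf.adj i i.2, fun i j hij => ?_⟩, ?_⟩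
  · exact Fin.ext (hf.inj (Set.mem_Iic.2 (by omega)) (Set.mem_Iic.2 (by omega)) hij)
  · rintro ⟨t, h1, h2, h⟩
    obtain ⟨t, rfl⟩ : ∃ s, t = s + 1 := ⟨t - 1, by omega⟩
    rcases h with ⟨h3, h4⟩ | ⟨h3, h4⟩
    · exact hf.nonCollider t h2 h3 h4
    · exact h4 (hf.collider t h2 h3.1 h3.2)

/-- Among DAGs with the same skeleton and the same unshielded colliders, d-separations of one
are d-separations of the other. -/
theorem dSep_of_same_colliders [Finite V] {G₁ G₂ : DAG V}
    (hadj : ∀ i j, G₁.Adj i j ↔ G₂.Adj i j)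
    (hcol : ∀ i k j, i ≠ j → ¬ G₁.Adj i j →
      (G₁.Edge i k ∧ G₁.Edge j k ↔ G₂.Edge i k ∧ G₂.Edge j k))
    {A B C : Set V} (hAB : Disjoint A B) (hAC : Disjoint A C) (h : G₂.dSep A B C) :
    G₁.dSep A B C := by
  intro a ha b hb π
  by_contra hπ
  have haC := Set.disjoint_left.1 hAC ha
  obtain ⟨_, h1⟩ := π.reach_of_not_blocked haC hπ
  obtain ⟨_, h2⟩ := h1.of_same_colliders G₁ G₂ hadj hcol
  obtain ⟨_, h3⟩ := h2.exists_openPathTo haC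
  obtain ⟨π', hπ'⟩ := h3.exists_path (by rintro rfl; exact Set.disjoint_left.1 hAB ha hb)
  exact hπ' (h a ha b hb π')

/-- DAGs with the same skeleton and the same unshielded colliders are Markov equivalent. -/
theorem markovEquiv_of_same_colliders [Finite V] {G₁ G₂ : DAG V}
    (hadj : ∀ i j, G₁.Adj i j ↔ G₂.Adj i j)
    (hcol : ∀ i k j, i ≠ j → ¬ G₁.Adj i j →
      (G₁.Edge i k ∧ G₁.Edge j k ↔ G₂.Edge i k ∧ G₂.Edge j k)) : MarkovEquiv G₁ G₂ :=
  fun _ _ _ hAB hAC _ =>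
    ⟨dSep_of_same_colliders (fun i j => (hadj i j).symm)
      (fun i k j hij hn => (hcol i k j hij (by rwa [hadj])).symm) hAB hAC,
     dSep_of_same_colliders hadj hcol hAB hAC⟩

end DAG

section

variable {V : Type*} {Ω : Type*} [MeasurableSpace Ω] [StandardBorelSpace Ω]
  {E : V → Type*} [∀ i, MeasurableSpace (E i)] {μ : Measure Ω} [IsFiniteMeasure μ]
  {X : ∀ i, Ω → E i} {hX : ∀ i, Measurable (X i)}

/-- Under V-stability, a collider with respect to which `P` is collider-stable is a collider in
every DAG with the skeleton of `P` with respect to which `P` is V-OUS. -/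
theorem VStable.isCollider (hV : VStable μ X hX) {G₁ G₂ : DAG V} (hs₁ : SkelEq μ X hX G₁)
    (hs₂ : SkelEq μ X hX G₂) (hc₁ : ColliderStable μ X hX G₁) (hv₂ : VOUS μ X hX G₂)
    {i k j : V} (h : G₁.IsCollider i k j) : G₂.IsCollider i k j := by
  have hadj : ∀ i j, G₁.Adj i j ↔ G₂.Adj i j := fun i j => (hs₁ i j).trans (hs₂ i j).symm
  obtain ⟨C, hC, hci⟩ := hc₁ i k j h
  obtain ⟨hij, hik, hjk, h1, h2, h3⟩ := h.1
  have hconf : G₂.VConfig i k j :=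
    ⟨hij, hik, hjk, (hadj _ _).1 h1, (hadj _ _).1 h2, fun h => h3 ((hadj _ _).2 h)⟩
  by_contra hn
  have hnon : G₂.IsNonCollider i k j := ⟨hconf, fun h => hn ⟨hconf, h⟩⟩
  exact hV i k j ⟨hij, hik, hjk, (hs₁ _ _).1 h1, (hs₁ _ _).1 h2, fun h => h3 ((hs₁ _ _).2 h)⟩
    C hC ⟨hci, hv₂ i k j hnon C hC hci⟩

end

variable {V : Type*} [Fintype V] {Ω : Type*} [MeasurableSpace Ω] [StandardBorelSpace Ω]
  [Nonempty Ω] {E : V → Type*} [∀ i, MeasurableSpace (E i)]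
  (μ : MeasureTheory.Measure Ω) [MeasureTheory.IsProbabilityMeasure μ]
  (X : ∀ i, Ω → E i) (hX : ∀ i, Measurable (X i))

/-- If `P` is V-stable then `P` is modified V-stable. -/
theorem stmt_8 (hV : VStable μ X hX) : ModifiedVStable μ X hX := by
  intro G₁ G₂ hs₁ hv₁ hc₁ hs₂ hv₂ hc₂
  have hadj : ∀ i j, G₁.Adj i j ↔ G₂.Adj i j := fun i j => (hs₁ i j).trans (hs₂ i j).symm
  refine DAG.markovEquiv_of_same_colliders hadj fun i k j hij hn => ⟨fun h => ?_, fun h => ?_⟩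
  · refine (hV.isCollider hs₁ hs₂ hc₁ hv₂ ⟨⟨hij, ?_, ?_, .inl h.1, .inl h.2, hn⟩, h⟩).2
    · rintro rfl; exact G₁.edge_irrefl _ h.1
    · rintro rfl; exact G₁.edge_irrefl _ h.2
  · refine (hV.isCollider hs₂ hs₁ hc₂ hv₁
      ⟨⟨hij, ?_, ?_, .inl h.1, .inl h.2, by rwa [← hadj]⟩, h⟩).2
    · rintro rfl; exact G₂.edge_irrefl _ h.1
    · rintro rfl; exact G₂.edge_irrefl _ h.2
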